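/- arXiv:2508.12417 — 3 statements merged into one kernel-verified Lean document; each statement's English description precedes it below -/
import Mathlib

section
/- Every ring of butterflies with m ≥ 7 links is nucleation-free: no subgraph of it on at least 5 vertices is rigid. -/
noncomputable section

open scoped RealInnerProductSpace

namespace Rigidity

variable {V : Type*}

/-- The row of the rigidity matrix of the framework `p` corresponding to the
ordered pair `(x, y)`: it has `p x - p y` in the three columns of `x`,
`p y - p x` in the three columns of `y`, and `0` elsewhere. -/
def rigidityRow [DecidableEq V] (p : V → Fin 3 → ℝ) (x y : V) : V × Fin 3 → ℝ :=
  fun vi =>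
    (if vi.1 = x then p x vi.2 - p y vi.2 else 0) +
    (if vi.1 = y then p y vi.2 - p x vi.2 else 0)

/-- The rank of the rigidity matrix of the framework `(G, p)`, i.e. the dimension of
the span of its rows (one row for each edge of `G`). -/
def rigidityRank [DecidableEq V] (G : SimpleGraph V) (p : V → Fin 3 → ℝ) : ℕ :=
  Module.finrank ℝ
    (Submodule.span ℝ {w : V × Fin 3 → ℝ | ∃ x y, G.Adj x y ∧ w = rigidityRow p x y})

/-- The generic 3-dimensional rank `rank₃ G`: the maximum, over all frameworks `p`,
of the rank of the rigidity matrix `R(G, p)`. -/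
def genRank [DecidableEq V] (G : SimpleGraph V) : ℕ :=
  sSup {n : ℕ | ∃ p : V → Fin 3 → ℝ, n = rigidityRank G p}

/-- `G` is independent in the generic 3-dimensional rigidity matroid. -/
def IsIndependent [DecidableEq V] (G : SimpleGraph V) : Prop :=
  genRank G = G.edgeSet.ncard

/-- `G` is (generically) rigid in dimension 3: `rank₃ G = 3|V| - 6`. -/
def IsRigid [DecidableEq V] (G : SimpleGraph V) : Prop :=
  genRank G = 3 * Nat.card V - 6

/-- `G` is nucleation-free: it has no rigid subgraph on at least 5 vertices. -/
def NucleationFree [DecidableEq V] (G : SimpleGraph V) : Prop :=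
  ∀ H : G.Subgraph, 5 ≤ H.verts.ncard → ¬ IsRigid H.coe

/-- The graph `G + {x,y}` obtained from `G` by adding the edge `{x, y}`. -/
def addEdge (G : SimpleGraph V) (x y : V) : SimpleGraph V :=
  G ⊔ SimpleGraph.fromEdgeSet {s(x, y)}

/-- `{x, y}` is an implied nonedge of `G`: it is a nonedge and adding it
does not change the generic 3-dimensional rank. -/
def ImpliedNonedge [DecidableEq V] (G : SimpleGraph V) (x y : V) : Prop :=
  x ≠ y ∧ ¬ G.Adj x y ∧ genRank (addEdge G x y) = genRank G

/-- `G` is a circuit of the generic 3-dimensional rigidity matroid: it is dependent and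
deleting any one edge yields an independent graph. -/
def IsCircuit [DecidableEq V] (G : SimpleGraph V) : Prop :=
  ¬ IsIndependent G ∧ ∀ e ∈ G.edgeSet, IsIndependent (G.deleteEdges {e})

/-- The vertex set `W` is contained in some `K₄` subgraph of `G`. -/
def ContainedInK4 (G : SimpleGraph V) (W : Set V) : Prop :=
  ∃ s : Set V, W ⊆ s ∧ s.ncard = 4 ∧ G.IsClique s

/-- The canonical ring of `m` butterflies: vertices `(i, 0) = aᵢ`, `(i, 1) = bᵢ` and
`(i, 2) = eᵢ`; link `i` is the complete graph on `aᵢ, bᵢ, eᵢ, aᵢ₊₁, bᵢ₊₁` minus the two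
hinge pairs `{aᵢ, bᵢ}` and `{aᵢ₊₁, bᵢ₊₁}` (a butterfly). -/
def butterflyRing (m : ℕ) : SimpleGraph (ZMod m × Fin 3) :=
  SimpleGraph.fromRel fun x y =>
    (x.1 = y.1 ∧ x ≠ y ∧ (x.2 = 2 ∨ y.2 = 2)) ∨ (y.1 = x.1 + 1 ∧ y.2 ≠ 2)

/-- `G` is a ring of `m` butterflies with hinges `{a i, b i}`. -/
def IsRingOfButterflies (m : ℕ) (G : SimpleGraph V) (a b : ZMod m → V) : Prop :=
  ∃ φ : G ≃g butterflyRing m, (∀ i, φ (a i) = (i, 0)) ∧ (∀ i, φ (b i) = (i, 1))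

/-- `G` is a ring of `m` butterflies with vertex set `S`, vertex labelling `f`
(all vertices of `V` outside `S` being isolated in `G`). -/
def IsRingOfButterfliesOn (m : ℕ) (G : SimpleGraph V) (S : Set V)
    (f : ZMod m × Fin 3 → V) : Prop :=
  Function.Injective f ∧ Set.range f = S ∧ G.support ⊆ S ∧
    ∀ x y, G.Adj (f x) (f y) ↔ (butterflyRing m).Adj x y

/-- `R` is a ring with links `L i` (subgraphs of `R`) and hinges `{a i, b i}`:
the links cover `R`, the `2m` hinge vertices are pairwise distinct, link `i` contains the
hinge vertices `a i, b i, a (i+1), b (i+1)`, and two distinct links share only hinge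
vertices common to both of them. -/
def IsRingDecomp (m : ℕ) (R : SimpleGraph V) (L : ZMod m → R.Subgraph)
    (a b : ZMod m → V) : Prop :=
  (⨆ i, (L i).spanningCoe) = R ∧
  Function.Injective (fun x : ZMod m × Bool => if x.2 then a x.1 else b x.1) ∧
  (∀ i, a i ∈ (L i).verts ∧ b i ∈ (L i).verts ∧
    a (i + 1) ∈ (L i).verts ∧ b (i + 1) ∈ (L i).verts) ∧
  (∀ i j, i ≠ j →
    (L i).verts ∩ (L j).verts ⊆
      ({a i, b i, a (i + 1), b (i + 1)} : Set V) ∩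
        ({a j, b j, a (j + 1), b (j + 1)} : Set V))

/-- The shared set `S(𝒳)` of a cover: all pairs `{x, y}` of distinct vertices such that
`{x, y} = X ∩ Y` for two distinct clusters `X, Y` of `𝒳`. -/
def sharedSet (𝒳 : Finset (Set V)) : Set (Sym2 V) :=
  {e | ∃ x y : V, x ≠ y ∧ e = s(x, y) ∧ ∃ X ∈ 𝒳, ∃ Y ∈ 𝒳, X ≠ Y ∧ X ∩ Y = {x, y}}

/-- `d(𝒳, e)`: the number of clusters of `𝒳` containing both endpoints of `e`. -/
def coverDeg (𝒳 : Finset (Set V)) (e : Sym2 V) : ℕ :=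
  {X : Set V | X ∈ 𝒳 ∧ ∀ v ∈ e, v ∈ X}.ncard

/-- `𝒳` is a 2-thin cover of `G`. -/
def IsTwoThinCover (G : SimpleGraph V) (𝒳 : Finset (Set V)) : Prop :=
  (∀ X ∈ 𝒳, 2 ≤ X.ncard) ∧
  (∀ X ∈ 𝒳, ∀ Y ∈ 𝒳, X ≠ Y → (X ∩ Y).ncard ≤ 2 ∧ ¬ X ⊂ Y) ∧
  (∀ x y : V, G.Adj x y → ∃ X ∈ 𝒳, x ∈ X ∧ y ∈ X)

/-- `Gs` is a nonedge-split of `G` at the nonedge `{a, b}` with new vertices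
`a₁, a₂, b₁, b₂`: the neighborhoods of `a₁, a₂` partition the neighborhood of `a`, the
neighborhoods of `b₁, b₂` partition the neighborhood of `b`, and `a`, `b` are deleted
(i.e. become isolated). -/
def IsNonedgeSplit (G Gs : SimpleGraph V) (a b a₁ a₂ b₁ b₂ : V) : Prop :=
  ¬ G.Adj a b ∧
  ([a, b, a₁, a₂, b₁, b₂] : List V).Pairwise (· ≠ ·) ∧
  a₁ ∉ G.support ∧ a₂ ∉ G.support ∧ b₁ ∉ G.support ∧ b₂ ∉ G.support ∧
  ∃ A ⊆ G.neighborSet a, ∃ B ⊆ G.neighborSet b,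
    Gs = (G.deleteEdges {e | a ∈ e ∨ b ∈ e}) ⊔
      SimpleGraph.fromEdgeSet
        (((fun w => s(a₁, w)) '' A) ∪ ((fun w => s(a₂, w)) '' (G.neighborSet a \ A)) ∪
         ((fun w => s(b₁, w)) '' B) ∪ ((fun w => s(b₂, w)) '' (G.neighborSet b \ B)))

/-- The double-butterfly on the eight vertices `a₁, a₂, b₁, b₂, u, v, c, c'`. -/
def doubleButterfly (a₁ a₂ b₁ b₂ u v c c' : V) : SimpleGraph V :=
  SimpleGraph.fromEdgeSet
    {s(a₁, u), s(a₁, v), s(a₂, u), s(a₂, v), s(b₁, u), s(b₁, v), s(b₂, u), s(b₂, v),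
     s(c, a₁), s(c, b₁), s(c, u), s(c, v), s(c', a₂), s(c', b₂), s(c', u), s(c', v)}

/-- `G'` is obtained from `G` by a double-butterfly split-and-glue at the nonedge
`{a, b}`: a nonedge-split of `G` at `{a, b}` with new vertices `a₁, a₂, b₁, b₂`, followed by
gluing a double-butterfly (with fresh vertices `u, v, c, c'`) along `a₁, a₂, b₁, b₂`. -/
def IsDoubleButterflySG (G G' : SimpleGraph V)
    (a b a₁ a₂ b₁ b₂ u v c c' : V) : Prop :=
  ∃ Gs : SimpleGraph V, IsNonedgeSplit G Gs a b a₁ a₂ b₁ b₂ ∧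
    ([a, b, a₁, a₂, b₁, b₂, u, v, c, c'] : List V).Pairwise (· ≠ ·) ∧
    u ∉ G.support ∧ v ∉ G.support ∧ c ∉ G.support ∧ c' ∉ G.support ∧
    G' = Gs ⊔ doubleButterfly a₁ a₂ b₁ b₂ u v c c'

/-- `s` is an equilibrium self-stress of the framework `(G, p)`. -/
def IsSelfStress [Fintype V] (G : SimpleGraph V) [DecidableRel G.Adj]
    (p : V → EuclideanSpace ℝ (Fin 3)) (s : Sym2 V → ℝ) : Prop :=
  ∀ x : V, (∑ y : V, if G.Adj x y then s s(x, y) • (p x - p y) else 0) = 0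

/-- `K(U)`: the edge set of the complete graph on the vertex set `U`. -/
def completeOn (U : Set V) : Set (Sym2 V) :=
  {e | ¬ e.IsDiag ∧ ∀ v ∈ e, v ∈ U}

/-- `V(E)`: the set of endpoints of the pairs in `E`. -/
def vertexSet (E : Set (Sym2 V)) : Set V := {v | ∃ e ∈ E, v ∈ e}

/-- `M` is an abstract `d`-rigidity matroid (axioms C1 and C2). -/
def IsAbstractRigidityMatroid (d : ℕ) (M : Matroid (Sym2 V)) : Prop :=
  (∀ E₁ E₂ : Set (Sym2 V), E₁ ⊆ M.E → E₂ ⊆ M.E →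
     (vertexSet E₁ ∩ vertexSet E₂).ncard ≤ d - 1 →
     M.closure (E₁ ∪ E₂) ⊆ completeOn (vertexSet E₁) ∪ completeOn (vertexSet E₂)) ∧
  (∀ E₁ E₂ : Set (Sym2 V), E₁ ⊆ M.E → E₂ ⊆ M.E →
     d ≤ (vertexSet E₁ ∩ vertexSet E₂).ncard →
     M.closure E₁ = completeOn (vertexSet E₁) →
     M.closure E₂ = completeOn (vertexSet E₂) →
     M.closure (E₁ ∪ E₂) = completeOn (vertexSet E₁ ∪ vertexSet E₂))

/-- The pair count of a chain of hinges, cut open at an empty hinge: `h j` and `e j` are the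
numbers of selected hinge vertices and apex vertices, respectively. -/
theorem chain_count (h e : ℕ → ℕ) (hh : ∀ j, h j ≤ 2) (he : ∀ j, e j ≤ 1) (h0 : h 0 = 0)
    (n : ℕ) :
    ∀ N E : ℕ, N = ∑ j ∈ Finset.range n, (h (j + 1) + e j) →
      E = ∑ j ∈ Finset.range n, (h j * e j + (h j + e j) * h (j + 1)) →
      E ≤ 3 * N ∧ (1 ≤ N → E + 3 ≤ 3 * N) ∧ (2 ≤ N → E + 5 ≤ 3 * N) ∧
        (3 ≤ N → E + 6 ≤ 3 * N) ∧ (5 ≤ N → E + 7 ≤ 3 * N) ∧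
        (h n = 2 → E + 6 ≤ 3 * N) ∧ h n ≤ N := by
  induction n with
  | zero =>
    rintro N E rfl rfl
    simp [h0]
  | succ n ih =>
    intro N E hN hE
    obtain ⟨i0, i1, i2, i3, i5, ih2, ihN⟩ := ih _ _ rfl rfl
    rw [Finset.sum_range_succ] at hN hE
    generalize ∑ j ∈ Finset.range n, (h (j + 1) + e j) = N' at *
    generalize ∑ j ∈ Finset.range n, (h j * e j + (h j + e j) * h (j + 1)) = E' at *
    have a1 := hh n
    have a2 := hh (n + 1)
    have a3 := he n
    generalize h n = x at *
    generalize h (n + 1) = y at *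
    generalize e n = z at *
    subst hN hE
    interval_cases x <;> interval_cases y <;> interval_cases z <;>
      refine ⟨?_, ?_, ?_, ?_, ?_, ?_, ?_⟩ <;> omega

theorem sum_zmod_eq_sum_range {m : ℕ} [NeZero m] (f : ZMod m → ℕ) (i₀ : ZMod m) :
    ∑ i, f i = ∑ j ∈ Finset.range m, f (i₀ + (j : ZMod m)) := by
  rw [← Equiv.sum_comp (Equiv.addLeft i₀) f]
  obtain ⟨k, rfl⟩ := Nat.exists_eq_succ_of_ne_zero (NeZero.ne m)
  rw [← Fin.sum_univ_eq_sum_range (fun j => f (i₀ + (j : ZMod (k + 1)))) (k + 1)]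
  refine Finset.sum_congr rfl fun i _ => ?_
  change f (i₀ + i) = _
  congr 2
  exact (ZMod.natCast_zmod_val (n := k + 1) i).symm

/-- The cyclic version of the pair count, for rings with at least seven links. -/
theorem ring_count {m : ℕ} [NeZero m] (hm : 7 ≤ m) (h e : ZMod m → ℕ) (hh : ∀ j, h j ≤ 2)
    (he : ∀ j, e j ≤ 1) (hN : 5 ≤ ∑ i, (h i + e i)) :
    ∑ i, (h i * e i + (h i + e i) * h (i + 1)) + 7 ≤ 3 * ∑ i, (h i + e i) := by
  have hshift : ∑ i, h (i + 1) = ∑ i, h i := Equiv.sum_comp (Equiv.addRight (1 : ZMod m)) h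
  by_cases hz : ∃ i₀, h i₀ = 0
  · obtain ⟨i₀, hi₀⟩ := hz
    have hsum : ∑ i, (h i + e i) = ∑ i, (h (i + 1) + e i) := by
      rw [Finset.sum_add_distrib, Finset.sum_add_distrib, hshift]
    rw [hsum] at hN ⊢
    have key := chain_count (fun j => h (i₀ + j)) (fun j => e (i₀ + j)) (fun _ => hh _)
      (fun _ => he _) (by simpa using hi₀) m _ _ rfl rfl
    rw [sum_zmod_eq_sum_range _ i₀] at hN
    rw [sum_zmod_eq_sum_range _ i₀, sum_zmod_eq_sum_range (fun i => h (i + 1) + e i) i₀]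
    simp only [Nat.cast_add, Nat.cast_one, ← add_assoc] at key hN ⊢
    exact key.2.2.2.2.1 hN
  · push Not at hz
    have hsum : 2 * ∑ i, (h i * e i + (h i + e i) * h (i + 1)) + ∑ _i : ZMod m, 2 ≤
        3 * ∑ i, (h i + h (i + 1) + 2 * e i) := by
      rw [Finset.mul_sum, Finset.mul_sum, ← Finset.sum_add_distrib]
      refine Finset.sum_le_sum fun i _ => ?_
      have a1 := hh i
      have a2 := hh (i + 1)
      have a3 := he i
      have a4 := Nat.pos_of_ne_zero (hz i)
      have a5 := Nat.pos_of_ne_zero (hz (i + 1))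
      generalize h i = x at *
      generalize h (i + 1) = y at *
      generalize e i = z at *
      interval_cases x <;> interval_cases y <;> interval_cases z <;> omega
    simp only [Finset.sum_add_distrib, ← Finset.mul_sum, hshift, Finset.sum_const,
      Finset.card_univ, ZMod.card, smul_eq_mul] at hsum ⊢
    omega

theorem rigidityRow_comm [DecidableEq V] (p : V → Fin 3 → ℝ) (x y : V) :
    rigidityRow p x y = rigidityRow p y x := by
  ext vi
  exact add_comm _ _

/-- The generic rank is at most the number of pairs in any set of ordered pairs that contains
an orientation of every edge. -/
theorem genRank_le_card [DecidableEq V] (G : SimpleGraph V) (P : Finset (V × V))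
    (hP : ∀ x y, G.Adj x y → (x, y) ∈ P ∨ (y, x) ∈ P) : genRank G ≤ P.card := by
  classical
  refine csSup_le ⟨_, 0, rfl⟩ ?_
  rintro _ ⟨p, rfl⟩
  have hsub : {w : V × Fin 3 → ℝ | ∃ x y, G.Adj x y ∧ w = rigidityRow p x y} ⊆
      (P.image fun q => rigidityRow p q.1 q.2 : Finset (V × Fin 3 → ℝ)) := by
    rintro _ ⟨x, y, hxy, rfl⟩
    rw [Finset.mem_coe, Finset.mem_image]
    rcases hP x y hxy with h | h
    · exact ⟨_, h, rfl⟩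
    · exact ⟨_, h, rigidityRow_comm p y x⟩
  calc rigidityRank G p
      ≤ Module.finrank ℝ (Submodule.span ℝ
          ((P.image fun q => rigidityRow p q.1 q.2 : Finset (V × Fin 3 → ℝ)) :
            Set (V × Fin 3 → ℝ))) := Submodule.finrank_mono (Submodule.span_mono hsub)
    _ ≤ _ := finrank_span_finset_le_card _
    _ ≤ P.card := Finset.card_image_le

/-- A graph on at least five vertices that maps injectively into a ring of at least seven
butterflies has too few edges to be rigid. -/
theorem genRank_add_seven_le [DecidableEq V] [Fintype V] {m : ℕ} (hm : 7 ≤ m)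
    (G : SimpleGraph V) (ψ : V → ZMod m × Fin 3) (hψ : Function.Injective ψ)
    (hG : ∀ x y, G.Adj x y → (butterflyRing m).Adj (ψ x) (ψ y)) (hV : 5 ≤ Fintype.card V) :
    genRank G + 7 ≤ 3 * Fintype.card V := by
  have : NeZero m := ⟨by omega⟩
  let A : ZMod m → Finset V := fun i => {v | (ψ v).1 = i ∧ (ψ v).2 ≠ 2}
  let B : ZMod m → Finset V := fun i => {v | (ψ v).1 = i ∧ (ψ v).2 = 2}
  have hA (i) : (A i).card ≤ 2 := by
    refine (Finset.card_le_card_of_injOn (t := {0, 1}) (fun v => (ψ v).2) ?_ ?_).trans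
      Finset.card_le_two
    · intro v hv
      have hv : (ψ v).2 ≠ 2 := (Finset.mem_filter.mp hv).2.2
      change (ψ v).2 ∈ ((({0, 1} : Finset (Fin 3)) : Set (Fin 3)))
      generalize (ψ v).2 = k at hv ⊢
      fin_cases k <;> simp_all
    · intro v hv w hw hvw
      exact hψ (Prod.ext ((Finset.mem_filter.mp hv).2.1.trans (Finset.mem_filter.mp hw).2.1.symm)
        hvw)
  have hB (i) : (B i).card ≤ 1 := by
    refine Finset.card_le_one.mpr fun v hv w hw => ?_
    have hv := (Finset.mem_filter.mp hv).2
    have hw := (Finset.mem_filter.mp hw).2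
    exact hψ (Prod.ext (hv.1.trans hw.1.symm) (hv.2.trans hw.2.symm))
  have hcard : Fintype.card V = ∑ i, ((A i).card + (B i).card) := by
    rw [← Finset.card_univ, Finset.card_eq_sum_card_fiberwise (f := fun v => (ψ v).1)
      (t := Finset.univ) (fun _ _ => Finset.mem_univ _)]
    refine Finset.sum_congr rfl fun i _ => ?_
    rw [← Finset.card_filter_add_card_filter_not (fun v => (ψ v).2 ≠ 2), Finset.filter_filter,
      Finset.filter_filter]
    simp only [A, B, not_not]
  let P : Finset (V × V) :=
    Finset.univ.biUnion fun i => A i ×ˢ B i ∪ (A i ∪ B i) ×ˢ A (i + 1)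
  have hPcard : P.card ≤ ∑ i, ((A i).card * (B i).card +
      ((A i).card + (B i).card) * (A (i + 1)).card) := by
    refine Finset.card_biUnion_le.trans (Finset.sum_le_sum fun i _ => ?_)
    refine (Finset.card_union_le _ _).trans ?_
    rw [Finset.card_product, Finset.card_product]
    gcongr
    exact Finset.card_union_le _ _
  have hP : ∀ x y, G.Adj x y → (x, y) ∈ P ∨ (y, x) ∈ P := by
    intro x y hxy
    have h := hG x y hxy
    simp only [butterflyRing, SimpleGraph.fromRel_adj] at h
    simp only [P, A, B, Finset.mem_biUnion, Finset.mem_union, Finset.mem_product,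
      Finset.mem_filter, Finset.mem_univ, true_and]
    have hne (h1 : (ψ x).1 = (ψ y).1) : (ψ x).2 ≠ (ψ y).2 := fun h2 => h.1 (Prod.ext h1 h2)
    by_cases hx : (ψ x).2 = 2 <;> by_cases hy : (ψ y).2 = 2 <;> grind
  have := ring_count hm (fun i => (A i).card) (fun i => (B i).card) hA hB (hcard ▸ hV)
  have := genRank_le_card G P hP
  omega

/-- Every ring of butterflies with `m ≥ 7` links is nucleation-free:
no subgraph of it on at least 5 vertices is rigid. -/
theorem ringOfButterflies_nucleationFree {V : Type*} [DecidableEq V]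
    (m : ℕ) (hm : 7 ≤ m) (G : SimpleGraph V) (a b : ZMod m → V)
    (hring : IsRingOfButterflies m G a b) :
    NucleationFree G := by
  obtain ⟨φ, -, -⟩ := hring
  intro H hH hrigid
  have : Finite H.verts := Set.finite_of_ncard_pos (by omega)
  have := Fintype.ofFinite H.verts
  have hcard : H.verts.ncard = Fintype.card H.verts := by
    rw [← Nat.card_coe_set_eq, Nat.card_eq_fintype_card]
  have hle := genRank_add_seven_le hm H.coe (fun v => φ v)
    (φ.injective.comp Subtype.val_injective)
    (fun x y hxy => φ.map_adj_iff.mpr (H.adj_sub hxy)) (hcard ▸ hH)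
  rw [IsRigid, Nat.card_eq_fintype_card] at hrigid
  omega

end Rigidity
end
end

section
/- Every ring of butterflies with m links, 3 ≤ m ≤ 5, is dependent, i.e., rank₃(R_m) < |E(R_m)|. -/
noncomputable section

open scoped RealInnerProductSpace

namespace Rigidity

variable {V : Type*}

/-- The matrix whose kernel is the set of assignments of forces to the vertices of the
framework `p` with vanishing resultant and vanishing total moment. -/
def equilibriumMatrix {V : Type*} (p : V → Fin 3 → ℝ) :
    Matrix (Fin 3 ⊕ Fin 3) (V × Fin 3) ℝ :=
  fun k vi => Sum.elim (fun j => Pi.single (M := fun _ => ℝ) vi.2 1 j)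
    (fun j => crossProduct (p vi.1) (Pi.single vi.2 1) j) k

lemma equilibriumMatrix_transpose_mulVec {V : Type*} (p : V → Fin 3 → ℝ)
    (u : Fin 3 ⊕ Fin 3 → ℝ) (x : V) (i : Fin 3) :
    ((equilibriumMatrix p).transpose.mulVec u) (x, i) =
      u (Sum.inl i) + crossProduct (fun j => u (Sum.inr j)) (p x) i := by
  fin_cases i <;>
    simp [equilibriumMatrix, Matrix.mulVec, dotProduct, Fin.sum_univ_three, crossProduct,
      Pi.single_apply] <;> ring

lemma equilibriumMatrix_mulVec_rigidityRow {V : Type*} [DecidableEq V] [Fintype V]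
    (p : V → Fin 3 → ℝ) (x y : V) :
    (equilibriumMatrix p).mulVec (rigidityRow p x y) = 0 := by
  ext k
  rcases k with k | k <;> fin_cases k <;>
    simp [equilibriumMatrix, Matrix.mulVec, dotProduct, Fintype.sum_prod_type,
      Fin.sum_univ_three, crossProduct, Pi.single_apply, rigidityRow, mul_add,
      Finset.sum_add_distrib] <;> ring

/-- If all edge directions of a framework are parallel to a fixed vector, then its rank is
at most the number of vertices. -/
lemma rigidityRank_le_card_of_parallel {V : Type*} [DecidableEq V] [Fintype V]
    (G : SimpleGraph V) (p : V → Fin 3 → ℝ) (w : Fin 3 → ℝ)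
    (h : ∀ x y, ∃ c : ℝ, p x - p y = c • w) : rigidityRank G p ≤ Fintype.card V := by
  let T : (V → ℝ) →ₗ[ℝ] (V × Fin 3 → ℝ) :=
    { toFun := fun f vi => f vi.1 * w vi.2
      map_add' := fun f g => by ext; simp [add_mul]
      map_smul' := fun c f => by ext; simp [mul_assoc] }
  have hle : Submodule.span ℝ
      {r : V × Fin 3 → ℝ | ∃ x y, G.Adj x y ∧ r = rigidityRow p x y} ≤ LinearMap.range T := by
    rw [Submodule.span_le]
    rintro _ ⟨x, y, -, rfl⟩
    obtain ⟨c, hc⟩ := h x y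
    refine ⟨fun v => (if v = x then c else 0) + (if v = y then -c else 0), ?_⟩
    ext ⟨v, i⟩
    have hi : p x i - p y i = c * w i := congrFun hc i
    have hi' : p y i - p x i = -c * w i := by linarith
    simp only [T, LinearMap.coe_mk, AddHom.coe_mk, rigidityRow, hi, hi', add_mul, ite_mul,
      zero_mul]
  calc rigidityRank G p ≤ Module.finrank ℝ (LinearMap.range T) := Submodule.finrank_mono hle
    _ ≤ Module.finrank ℝ (V → ℝ) := LinearMap.finrank_range_le T
    _ = Fintype.card V := Module.finrank_fintype_fun_eq_card ℝ

lemma exists_eq_smul_of_crossProduct_eq_zero {w v : Fin 3 → ℝ} (hw : w ≠ 0)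
    (h : crossProduct w v = 0) : ∃ c : ℝ, v = c • w := by
  have h0 := congrFun h 0
  have h1 := congrFun h 1
  have h2 := congrFun h 2
  simp [crossProduct] at h0 h1 h2
  obtain ⟨i, hi⟩ := Function.ne_iff.mp hw
  refine ⟨v i / w i, ?_⟩
  ext j
  simp only [Pi.zero_apply, ne_eq] at hi
  rw [Pi.smul_apply, smul_eq_mul, div_mul_eq_mul_div, eq_div_iff hi]
  fin_cases i <;> fin_cases j <;> simp <;> linarith

/-- Every framework on at least three vertices has rank at most `3|V| - 6`. -/
lemma rigidityRank_add_six_le {V : Type*} [DecidableEq V] [Fintype V]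
    (G : SimpleGraph V) (p : V → Fin 3 → ℝ) (hV : 3 ≤ Fintype.card V) :
    rigidityRank G p + 6 ≤ 3 * Fintype.card V := by
  by_cases hinj : Function.Injective (equilibriumMatrix p).transpose.mulVecLin
  · have hrank : (equilibriumMatrix p).rank = 6 := by
      rw [← Matrix.rank_transpose, Matrix.rank, LinearMap.finrank_range_of_inj hinj]
      simp
    have hsum := (equilibriumMatrix p).mulVecLin.finrank_range_add_finrank_ker
    have hle : rigidityRank G p ≤
        Module.finrank ℝ (LinearMap.ker (equilibriumMatrix p).mulVecLin) := by
      apply Submodule.finrank_mono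
      rw [Submodule.span_le]
      rintro _ ⟨x, y, -, rfl⟩
      exact equilibriumMatrix_mulVec_rigidityRow p x y
    rw [Matrix.rank] at hrank
    simp only [Module.finrank_fintype_fun_eq_card, Fintype.card_prod, Fintype.card_fin] at hsum
    omega
  · rw [injective_iff_map_eq_zero] at hinj
    push Not at hinj
    obtain ⟨u, hu, hu0⟩ := hinj
    have hmotion : ∀ x i,
        u (Sum.inl i) + crossProduct (fun j => u (Sum.inr j)) (p x) i = 0 := by
      intro x i
      rw [← equilibriumMatrix_transpose_mulVec]
      exact congrFun hu (x, i)
    have hw : (fun j => u (Sum.inr j)) ≠ 0 := by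
      intro hw
      obtain ⟨x⟩ : Nonempty V := Fintype.card_pos_iff.mp (by omega)
      apply hu0
      ext (i | i)
      · simpa [hw] using hmotion x i
      · exact congrFun hw i
    have hle := rigidityRank_le_card_of_parallel G p _ fun x y => by
      refine exists_eq_smul_of_crossProduct_eq_zero hw ?_
      ext i
      have hx := hmotion x i
      have hy := hmotion y i
      rw [map_sub, Pi.sub_apply, Pi.zero_apply]
      linarith
    omega

lemma genRank_add_six_le {V : Type*} [DecidableEq V] [Fintype V]
    (G : SimpleGraph V) (hV : 3 ≤ Fintype.card V) :
    genRank G + 6 ≤ 3 * Fintype.card V := by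
  have h : genRank G ≤ 3 * Fintype.card V - 6 := by
    refine csSup_le ⟨_, 0, rfl⟩ ?_
    rintro _ ⟨p, rfl⟩
    have := rigidityRank_add_six_le G p hV
    omega
  omega

instance (m : ℕ) : DecidableRel (butterflyRing m).Adj := fun x y =>
  decidable_of_iff _ (SimpleGraph.fromRel_adj _ x y).symm

lemma ncard_edgeSet_of_sum_degrees {V : Type*} [Fintype V] [DecidableEq V]
    (G : SimpleGraph V) [DecidableRel G.Adj] {n : ℕ} (h : ∑ v, G.degree v = 2 * n) :
    G.edgeSet.ncard = n := by
  rw [← SimpleGraph.coe_edgeFinset, Set.ncard_coe_finset]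
  have := G.sum_degrees_eq_twice_card_edges
  omega

lemma ncard_edgeSet_butterflyRing {m : ℕ} (hm3 : 3 ≤ m) (hm5 : m ≤ 5) :
    (butterflyRing m).edgeSet.ncard = 8 * m := by
  interval_cases m <;> exact ncard_edgeSet_of_sum_degrees _ (by decide +kernel)

/-- Every ring of butterflies with `m` links, `3 ≤ m ≤ 5`, is dependent,
i.e. `rank₃(R_m) < |E(R_m)|`. -/
theorem ringOfButterflies_dependent {V : Type*} [DecidableEq V]
    (m : ℕ) (hm3 : 3 ≤ m) (hm5 : m ≤ 5) (G : SimpleGraph V) (a b : ZMod m → V)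
    (hring : IsRingOfButterflies m G a b) :
    genRank G < G.edgeSet.ncard := by
  obtain ⟨φ, -, -⟩ := hring
  have : NeZero m := ⟨by omega⟩
  let _ : Fintype V := Fintype.ofEquiv _ φ.toEquiv.symm
  have hcard : Fintype.card V = 3 * m := by
    rw [Fintype.card_congr φ.toEquiv, Fintype.card_prod, ZMod.card, Fintype.card_fin, mul_comm]
  have hedge : G.edgeSet.ncard = 8 * m :=
    (Set.ncard_congr' φ.mapEdgeSet).trans (ncard_edgeSet_butterflyRing hm3 hm5)
  have := genRank_add_six_le G (by omega)
  omega

end Rigidity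
end
end

section
/- Every ring of butterflies R_m with 3 ≤ m ≤ 6 links is rigid: rank₃(R_m) = 3|V(R_m)| − 6 = 9m − 6. -/
noncomputable section

open scoped RealInnerProductSpace

namespace Rigidity

variable {V : Type*}

section UpperBound

open Matrix

/-- The velocity field of the infinitesimal isometry with translation part `z.1` and
rotation part `z.2`, evaluated on the framework `p`. -/
def trivialMotion (p : V → Fin 3 → ℝ) :
    ((Fin 3 → ℝ) × (Fin 3 → ℝ)) →ₗ[ℝ] (V × Fin 3 → ℝ) where
  toFun z vi := z.1 vi.2 + (z.2 ⨯₃ p vi.1) vi.2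
  map_add' y z := by
    ext vi
    simp only [Prod.fst_add, Prod.snd_add, map_add, LinearMap.add_apply, Pi.add_apply]
    ring
  map_smul' r z := by
    ext vi
    simp only [Prod.smul_fst, Prod.smul_snd, map_smul, LinearMap.smul_apply, Pi.smul_apply,
      smul_eq_mul, RingHom.id_apply]
    ring

lemma rigidityRow_dotProduct_trivialMotion [Fintype V] [DecidableEq V] (p : V → Fin 3 → ℝ)
    (x y : V) (z : (Fin 3 → ℝ) × (Fin 3 → ℝ)) :
    rigidityRow p x y ⬝ᵥ trivialMotion p z = 0 := by
  simp only [dotProduct, rigidityRow, trivialMotion, LinearMap.coe_mk, AddHom.coe_mk,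
    Fintype.sum_prod_type, add_mul, ite_mul, zero_mul, Finset.sum_add_distrib,
    Fin.sum_univ_three, Finset.sum_ite_eq', Finset.mem_univ, if_true, cross_apply,
    Matrix.cons_val_zero, Matrix.cons_val_one, Matrix.cons_val]
  ring

lemma span_rigidityRow_le_ker [Fintype V] [DecidableEq V] (G : SimpleGraph V)
    (p : V → Fin 3 → ℝ) :
    Submodule.span ℝ {w : V × Fin 3 → ℝ | ∃ x y, G.Adj x y ∧ w = rigidityRow p x y} ≤
      LinearMap.ker ((trivialMotion p).dualMap ∘ₗ
        (dotProductEquiv ℝ (V × Fin 3)).toLinearMap) := by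
  rw [Submodule.span_le]
  rintro _ ⟨x, y, -, rfl⟩
  refine LinearMap.ext fun z => ?_
  exact rigidityRow_dotProduct_trivialMotion p x y z

/-- If some nonzero infinitesimal isometry fixes every point of `p`, then `p` is collinear. -/
lemma exists_line_of_trivialMotion_eq_zero (p : V → Fin 3 → ℝ)
    {z : (Fin 3 → ℝ) × (Fin 3 → ℝ)} (hz : z ≠ 0) (h : trivialMotion p z = 0) :
    ∃ (d : Fin 3 → ℝ) (s : V → V → ℝ), ∀ x y, p x - p y = s x y • d := by
  obtain ⟨t, d⟩ := z
  have hfix (v : V) (c : Fin 3) : t c + (d ⨯₃ p v) c = 0 := congrFun h (v, c)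
  rcases isEmpty_or_nonempty V with hV | ⟨⟨v⟩⟩
  · exact ⟨0, fun _ _ => 0, fun x => hV.elim x⟩
  have hd : d ≠ 0 := by
    rintro rfl
    refine hz (Prod.ext (funext fun c => ?_) rfl)
    simpa using hfix v c
  have hdd : d ⬝ᵥ d ≠ 0 := by simpa using hd
  refine ⟨d, fun x y => ((p x - p y) ⬝ᵥ d) / (d ⬝ᵥ d), fun x y => ?_⟩
  have hx := hfix x
  have hy := hfix y
  simp only [Fin.forall_fin_succ, cross_apply] at hx hy
  simp at hx hy
  obtain ⟨hx0, hx1, hx2⟩ := hx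
  obtain ⟨hy0, hy1, hy2⟩ := hy
  ext c
  simp only [Pi.smul_apply, smul_eq_mul, Pi.sub_apply]
  rw [div_mul_eq_mul_div, eq_div_iff hdd]
  simp only [dotProduct, Fin.sum_univ_three, Pi.sub_apply]
  fin_cases c <;> simp
  · linear_combination (-d 1) * hx2 + d 1 * hy2 + d 2 * hx1 - d 2 * hy1
  · linear_combination (d 0) * hx2 - d 0 * hy2 - d 2 * hx0 + d 2 * hy0
  · linear_combination (d 1) * hx0 - d 1 * hy0 - d 0 * hx1 + d 0 * hy1

lemma rigidityRank_le_card_of_line [Fintype V] [DecidableEq V] (G : SimpleGraph V)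
    (p : V → Fin 3 → ℝ) {d : Fin 3 → ℝ} {s : V → V → ℝ}
    (h : ∀ x y, p x - p y = s x y • d) : rigidityRank G p ≤ Fintype.card V := by
  let f : (V → ℝ) →ₗ[ℝ] (V × Fin 3 → ℝ) :=
    LinearMap.pi fun vi => d vi.2 • LinearMap.proj vi.1
  have hle : Submodule.span ℝ
      {w : V × Fin 3 → ℝ | ∃ x y, G.Adj x y ∧ w = rigidityRow p x y} ≤ LinearMap.range f := by
    rw [Submodule.span_le]
    rintro _ ⟨x, y, -, rfl⟩
    refine ⟨fun v => (if v = x then s x y else 0) + (if v = y then s y x else 0), ?_⟩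
    ext ⟨v, c⟩
    have hxy := congrFun (h x y) c
    have hyx := congrFun (h y x) c
    simp only [Pi.sub_apply, Pi.smul_apply, smul_eq_mul] at hxy hyx
    simp only [f, rigidityRow, LinearMap.pi_apply, LinearMap.smul_apply, LinearMap.proj_apply,
      smul_eq_mul, hxy, hyx]
    split_ifs <;> ring
  calc rigidityRank G p ≤ Module.finrank ℝ (LinearMap.range f) := Submodule.finrank_mono hle
    _ ≤ Module.finrank ℝ (V → ℝ) := LinearMap.finrank_range_le f
    _ = Fintype.card V := Module.finrank_fintype_fun_eq_card ℝ

theorem rigidityRank_le [Fintype V] [DecidableEq V] (G : SimpleGraph V)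
    (p : V → Fin 3 → ℝ) (hV : 3 ≤ Fintype.card V) :
    rigidityRank G p ≤ 3 * Fintype.card V - 6 := by
  by_cases hinj : Function.Injective (trivialMotion p)
  · have hsurj : Function.Surjective ((trivialMotion p).dualMap ∘ₗ
        (dotProductEquiv ℝ (V × Fin 3)).toLinearMap) :=
      (LinearMap.dualMap_surjective_of_injective hinj).comp
        (dotProductEquiv ℝ (V × Fin 3)).surjective
    have hdim := LinearMap.finrank_range_add_finrank_ker ((trivialMotion p).dualMap ∘ₗ
        (dotProductEquiv ℝ (V × Fin 3)).toLinearMap)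
    rw [LinearMap.range_eq_top.2 hsurj, finrank_top, Subspace.dual_finrank_eq] at hdim
    have hker := Submodule.finrank_mono (span_rigidityRow_le_ker G p)
    simp only [Module.finrank_prod, Module.finrank_fintype_fun_eq_card, Fintype.card_prod,
      Fintype.card_fin] at hdim
    unfold rigidityRank
    omega
  · rw [injective_iff_map_eq_zero] at hinj
    push Not at hinj
    obtain ⟨z, hz, hz0⟩ := hinj
    obtain ⟨d, s, h⟩ := exists_line_of_trivialMotion_eq_zero p hz0 hz
    have := rigidityRank_le_card_of_line G p h
    omega

theorem genRank_le [Fintype V] [DecidableEq V] (G : SimpleGraph V)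
    (hV : 3 ≤ Fintype.card V) : genRank G ≤ 3 * Fintype.card V - 6 := by
  refine csSup_le ⟨_, 0, rfl⟩ ?_
  rintro _ ⟨p, rfl⟩
  exact rigidityRank_le G p hV

theorem rigidityRank_le_genRank [Fintype V] [DecidableEq V] (G : SimpleGraph V)
    (p : V → Fin 3 → ℝ) (hV : 3 ≤ Fintype.card V) : rigidityRank G p ≤ genRank G := by
  refine le_csSup ⟨3 * Fintype.card V - 6, ?_⟩ ⟨p, rfl⟩
  rintro _ ⟨q, rfl⟩
  exact rigidityRank_le G q hV

end UpperBound

section Iso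

variable {W : Type*} [DecidableEq V] [DecidableEq W]

lemma rigidityRank_comp_iso {G : SimpleGraph V} {H : SimpleGraph W} (φ : G ≃g H)
    (q : W → Fin 3 → ℝ) : rigidityRank G (q ∘ φ) = rigidityRank H q := by
  let e : (W × Fin 3 → ℝ) ≃ₗ[ℝ] (V × Fin 3 → ℝ) :=
    LinearEquiv.funCongrLeft ℝ ℝ (φ.toEquiv.prodCongr (Equiv.refl (Fin 3)))
  have hrow (x y : V) : e (rigidityRow q (φ x) (φ y)) = rigidityRow (q ∘ φ) x y := by
    ext ⟨v, c⟩
    simp [e, rigidityRow, LinearEquiv.funCongrLeft_apply, LinearMap.funLeft_apply]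
  have himage : {w | ∃ x y, G.Adj x y ∧ w = rigidityRow (q ∘ φ) x y} =
      e '' {w | ∃ x y, H.Adj x y ∧ w = rigidityRow q x y} := by
    ext w
    constructor
    · rintro ⟨x, y, hxy, rfl⟩
      exact ⟨_, ⟨φ x, φ y, φ.map_adj_iff.2 hxy, rfl⟩, hrow x y⟩
    · rintro ⟨_, ⟨x, y, hxy, rfl⟩, rfl⟩
      refine ⟨φ.symm x, φ.symm y, φ.symm.map_adj_iff.2 hxy, ?_⟩
      simpa using hrow (φ.symm x) (φ.symm y)
  unfold rigidityRank
  rw [himage, ← LinearEquiv.finrank_map_eq e, Submodule.map_span]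
  rfl

end Iso

section Elimination

/-- The list `s - c • r`, where the shorter list is padded with zeros. -/
def subMul (c : ℚ) : List ℚ → List ℚ → List ℚ
  | s, [] => s
  | [], b :: r => (if b = 0 then 0 else -(c * b)) :: subMul c [] r
  | a :: s, b :: r => (if b = 0 then a else a - c * b) :: subMul c s r

/-- Gaussian elimination: a lower bound for the rank of a list of rows, obtained with at most
`n` steps. -/
def elimRank : ℕ → List (List ℚ) → ℕ
  | 0, _ => 0
  | _ + 1, [] => 0
  | n + 1, r :: rs =>
    let k := r.findIdx (· ≠ 0)
    if r.getD k 0 = 0 then elimRank n rs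
    else elimRank n (rs.map fun s =>
      if s.getD k 0 = 0 then s else subMul (s.getD k 0 / r.getD k 0) s r) + 1

/-- The real sequence given by a list of rationals, padded with zeros. -/
def toSeq (r : List ℚ) : ℕ → ℝ := fun j => (r.getD j 0 : ℚ)

lemma getD_subMul (c : ℚ) (s r : List ℚ) (j : ℕ) :
    (subMul c s r).getD j 0 = s.getD j 0 - c * r.getD j 0 := by
  induction s, r using subMul.induct generalizing j with
  | case1 s => simp [subMul]
  | case2 b r ih => cases j <;> simp_all [subMul]
  | case3 a s b r ih => cases j <;> simp_all [subMul]

lemma toSeq_subMul (c : ℚ) (s r : List ℚ) :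
    toSeq (subMul c s r) = toSeq s - (c : ℝ) • toSeq r := by
  ext j
  simp [toSeq, getD_subMul, -List.getD_eq_getElem?_getD]

lemma elimRank_le_finrank (n : ℕ) (rs : List (List ℚ)) :
    elimRank n rs ≤ Module.finrank ℝ (Submodule.span ℝ (toSeq '' {r | r ∈ rs})) := by
  induction n generalizing rs with
  | zero => simp [elimRank]
  | succ n ih =>
    cases rs with
    | nil => simp [elimRank]
    | cons r rs =>
      have hfin : FiniteDimensional ℝ (Submodule.span ℝ (toSeq '' {s | s ∈ r :: rs})) :=
        FiniteDimensional.span_of_finite ℝ ((List.finite_toSet _).image _)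
      simp only [elimRank]
      generalize r.findIdx (· ≠ 0) = k
      split_ifs with hk
      · refine (ih rs).trans (Submodule.finrank_mono (Submodule.span_mono ?_))
        exact Set.image_mono fun s hs => List.mem_cons_of_mem r hs
      · set f : List ℚ → List ℚ := fun s =>
          if s.getD k 0 = 0 then s else subMul (s.getD k 0 / r.getD k 0) s r with hf
        set U := Submodule.span ℝ (toSeq '' {s | s ∈ rs.map f}) with hU
        have hsub : U ≤ Submodule.span ℝ (toSeq '' {s | s ∈ r :: rs}) := by
          rw [hU, Submodule.span_le]
          rintro _ ⟨_, hmem, rfl⟩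
          obtain ⟨s, hs, rfl⟩ := List.mem_map.1 hmem
          have hs' : toSeq s ∈ Submodule.span ℝ (toSeq '' {s | s ∈ r :: rs}) :=
            Submodule.subset_span ⟨s, List.mem_cons_of_mem r hs, rfl⟩
          have hr : toSeq r ∈ Submodule.span ℝ (toSeq '' {s | s ∈ r :: rs}) :=
            Submodule.subset_span ⟨r, List.mem_cons_self, rfl⟩
          simp only [hf]
          split_ifs
          · exact hs'
          · rw [toSeq_subMul]
            exact sub_mem hs' (Submodule.smul_mem _ _ hr)
        have hzero : U ≤ LinearMap.ker (LinearMap.proj (R := ℝ) (φ := fun _ : ℕ => ℝ) k) := by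
          rw [hU, Submodule.span_le]
          rintro _ ⟨_, hmem, rfl⟩
          obtain ⟨s, hs, rfl⟩ := List.mem_map.1 hmem
          have : (f s).getD k 0 = 0 := by
            simp only [hf]
            split_ifs with h
            · exact h
            · rw [getD_subMul, div_mul_cancel₀ _ hk, sub_self]
          simp [toSeq, this, -List.getD_eq_getElem?_getD]
        have hlt : U < Submodule.span ℝ (toSeq '' {s | s ∈ r :: rs}) := by
          refine lt_of_le_of_ne hsub fun h => hk ?_
          have hr : toSeq r ∈ U := h ▸ Submodule.subset_span ⟨r, List.mem_cons_self, rfl⟩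
          have := hzero hr
          simpa [toSeq, -List.getD_eq_getElem?_getD] using this
        exact (Nat.succ_le_succ (ih _)).trans (Submodule.finrank_lt_finrank_of_lt hlt)

/-- The row of the edge `e` in the rigidity matrix of a rational framework, restricted to the
columns listed in `cols`. -/
def rationalRow [DecidableEq V] (p : V → Fin 3 → ℚ) (cols : List (V × Fin 3)) (e : V × V) :
    List ℚ :=
  cols.map fun vi =>
    if vi.1 = e.1 then p e.1 vi.2 - p e.2 vi.2
    else if vi.1 = e.2 then p e.2 vi.2 - p e.1 vi.2 else 0

/-- Reading off the entries of a vector in the order given by `cols`, padded with zeros. -/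
def readColumns (cols : List (V × Fin 3)) : (V × Fin 3 → ℝ) →ₗ[ℝ] (ℕ → ℝ) :=
  LinearMap.pi fun j => (cols[j]?).elim 0 fun vi => LinearMap.proj vi

lemma readColumns_rigidityRow [DecidableEq V] (p : V → Fin 3 → ℚ) (cols : List (V × Fin 3))
    {x y : V} (hxy : x ≠ y) :
    readColumns cols (rigidityRow (fun v c => (p v c : ℝ)) x y) =
      toSeq (rationalRow p cols (x, y)) := by
  ext j
  rcases h : cols[j]? with _ | ⟨v, c⟩
  · simp [readColumns, toSeq, rationalRow, h]
  · simp only [readColumns, toSeq, rationalRow, h, LinearMap.pi_apply, Option.elim_some,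
      LinearMap.proj_apply, rigidityRow, List.getD_eq_getElem?_getD, List.getElem?_map,
      Option.map_some, Option.getD_some]
    split_ifs with h1 h2
    · exact absurd (h1.symm.trans h2) hxy
    all_goals simp

/-- Eliminating the rows of some edges of `G` in a rational framework bounds the rank of the
rigidity matrix from below. -/
theorem elimRank_le_rigidityRank [Finite V] [DecidableEq V] (G : SimpleGraph V)
    (p : V → Fin 3 → ℚ) (cols : List (V × Fin 3)) (edges : List (V × V))
    (hedges : ∀ e ∈ edges, G.Adj e.1 e.2) :
    elimRank edges.length (edges.map (rationalRow p cols)) ≤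
      rigidityRank G fun v c => (p v c : ℝ) := by
  refine (elimRank_le_finrank _ _).trans ?_
  refine (Submodule.finrank_mono ?_).trans (Submodule.finrank_map_le (readColumns cols) _)
  rw [Submodule.span_le]
  rintro _ ⟨_, hr, rfl⟩
  obtain ⟨e, he, rfl⟩ := List.mem_map.1 hr
  exact ⟨_, Submodule.subset_span ⟨e.1, e.2, hedges e he, rfl⟩,
    readColumns_rigidityRow p cols (hedges e he).ne⟩

end Elimination

section Ring

/-- The edges of the canonical ring of `m` butterflies, link by link. -/
def butterflyEdges (m : ℕ) : List ((ZMod m × Fin 3) × (ZMod m × Fin 3)) :=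
  (List.range m).flatMap fun i =>
    [(((i : ZMod m), 2), ((i : ZMod m), 0)), (((i : ZMod m), 2), ((i : ZMod m), 1))] ++
      (List.finRange 3).flatMap fun k =>
        [(((i : ZMod m), k), ((i : ZMod m) + 1, 0)), (((i : ZMod m), k), ((i : ZMod m) + 1, 1))]

/-- The columns of the rigidity matrix of the canonical ring of `m` butterflies. -/
def butterflyColumns (m : ℕ) : List ((ZMod m × Fin 3) × Fin 3) :=
  ((List.range m).map fun i => (i : ZMod m)) ×ˢ List.finRange 3 ×ˢ List.finRange 3 |>.map
    fun x => ((x.1, x.2.1), x.2.2)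

/-- Points on the moment curve modulo `11`. -/
def butterflyFramework (m : ℕ) (v : ZMod m × Fin 3) (c : Fin 3) : ℚ :=
  (((3 * v.1.val + v.2.val) ^ (c.val + 1) % 11 : ℕ) : ℚ)

lemma adj_of_mem_butterflyEdges {m : ℕ} (hm : 2 ≤ m)
    (e : (ZMod m × Fin 3) × (ZMod m × Fin 3)) (he : e ∈ butterflyEdges m) :
    (butterflyRing m).Adj e.1 e.2 := by
  have : Fact (1 < m) := ⟨hm⟩
  simp only [butterflyEdges, List.mem_flatMap, List.mem_append, List.mem_cons,
    List.not_mem_nil, or_false] at he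
  obtain ⟨i, -, (rfl | rfl) | ⟨k, -, rfl | rfl⟩⟩ := he <;>
    simp [butterflyRing, SimpleGraph.fromRel_adj]

lemma elimRank_butterfly {m : ℕ} (hm3 : 3 ≤ m) (hm6 : m ≤ 6) :
    elimRank (butterflyEdges m).length
      ((butterflyEdges m).map (rationalRow (butterflyFramework m) (butterflyColumns m))) =
        9 * m - 6 := by
  interval_cases m <;> decide +kernel

end Ring

/-- Every ring of butterflies `R_m` with `3 ≤ m ≤ 6` links is rigid:
`rank₃(R_m) = 3|V(R_m)| - 6 = 9m - 6`. -/
theorem ringOfButterflies_rigid {V : Type*} [DecidableEq V]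
    (m : ℕ) (hm3 : 3 ≤ m) (hm6 : m ≤ 6) (G : SimpleGraph V) (a b : ZMod m → V)
    (hring : IsRingOfButterflies m G a b) :
    genRank G = 3 * Nat.card V - 6 ∧ 3 * Nat.card V - 6 = 9 * m - 6 := by
  obtain ⟨φ, -, -⟩ := hring
  have : NeZero m := ⟨by omega⟩
  have : Fintype V := Fintype.ofEquiv _ φ.toEquiv.symm
  have hcard : Fintype.card V = 3 * m := by
    rw [Fintype.card_congr φ.toEquiv, Fintype.card_prod, ZMod.card, Fintype.card_fin, mul_comm]
  have hV : 3 ≤ Fintype.card V := by omega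
  rw [Nat.card_eq_fintype_card]
  refine ⟨le_antisymm (genRank_le G hV) ?_, by omega⟩
  calc 3 * Fintype.card V - 6 = 9 * m - 6 := by omega
    _ ≤ rigidityRank (butterflyRing m) fun v c => (butterflyFramework m v c : ℝ) :=
      (elimRank_butterfly hm3 hm6).ge.trans (elimRank_le_rigidityRank _ _ _ _
        (adj_of_mem_butterflyEdges (by omega)))
    _ = rigidityRank G _ := (rigidityRank_comp_iso φ _).symm
    _ ≤ genRank G := rigidityRank_le_genRank G _ hV

end Rigidity
end
end
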